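/- arXiv:1906.01481 — 2 statements merged into one kernel-verified Lean document; each statement's English description precedes it below -/
import Mathlib

section
/- Under the setup below, with 0 < η ≤ min{1/(8ℒ₁), 1/(6L_f)}, p ∈ (0,1] and α := 6η/(5p), for any x, w ∈ ℝ^d the following holds: Σ_C p_C P(x⁺_C) − P(x*) − (3/5)(P(x) − P(x*)) ≤ [ (1/(2η))‖x − x*‖² + α H(w) ] − [ Σ_C p_C (1/(2η))‖x⁺_C − x*‖² + α ( p·H(x) + (1−p)·H(w) ) ], where for each subset C with p_C > 0, g_C := (1/n) Σ_{i∈C} θ^i_C (∇f_i(x) − ∇f_i(w)) + ∇f(w), x⁺_C is a minimizer over ℝ^d of y ↦ (1/(2η))‖x − η g_C − y‖² + ψ(y), and H(u) := E_S ‖(1/n) Σ_{i∈S} θ^i_S (∇f_i(u) − ∇f_i(x*))‖². -/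
open scoped RealInnerProductSpace BigOperators

lemma aux_scalar (a b : ℝ) (h : ∀ t : ℝ, 0 < t → t ≤ 1 → 0 ≤ t * a + t ^ 2 * b) : 0 ≤ a := by
  by_contra ha
  push Not at ha
  have hb : 0 < |b| + 1 - a := by have := abs_nonneg b; linarith
  have ht : 0 < (-a) / (|b| + 1 - a) := div_pos (by linarith) hb
  have h1 := h _ ht (by rw [div_le_one hb]; have := abs_nonneg b; linarith)
  set t := (-a) / (|b| + 1 - a) with htd
  have h2 : t * (|b| + 1 - a) = -a := by rw [htd]; field_simp
  have h3 : 0 ≤ a + t * b := by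
    by_contra hc
    push Not at hc
    nlinarith
  have h4 : t * b ≤ t * |b| := mul_le_mul_of_nonneg_left (le_abs_self b) ht.le
  nlinarith

lemma aux_descent {E : Type*} [NormedAddCommGroup E] [InnerProductSpace ℝ E] [CompleteSpace E]
    (f : E → ℝ) (f' : E → E) (hf : ∀ x, HasGradientAt f (f' x) x) (L : ℝ)
    (hL : ∀ x y, ‖f' x - f' y‖ ≤ L * ‖x - y‖) (x v : E) :
    f (x + v) ≤ f x + ⟪f' x, v⟫ + L / 2 * ‖v‖ ^ 2 := by
  have hd : ∀ t : ℝ, HasDerivAt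
      (fun t : ℝ => f (x + t • v) - t * ⟪f' x, v⟫ - t ^ 2 * (L / 2 * ‖v‖ ^ 2))
      (⟪f' (x + t • v), v⟫ - ⟪f' x, v⟫ - 2 * t * (L / 2 * ‖v‖ ^ 2)) t := by
    intro t
    have h1 : HasDerivAt (fun t : ℝ => x + t • v) v t := by
      simpa using ((hasDerivAt_id t).smul_const v).const_add x
    have h2 := (hf (x + t • v)).hasFDerivAt.comp_hasDerivAt t h1
    have h3 : HasDerivAt (fun t : ℝ => t * ⟪f' x, v⟫) ⟪f' x, v⟫ t := by
      simpa using (hasDerivAt_id t).mul_const ⟪f' x, v⟫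
    have h4 : HasDerivAt (fun t : ℝ => t ^ 2 * (L / 2 * ‖v‖ ^ 2))
        (2 * t * (L / 2 * ‖v‖ ^ 2)) t := by
      simpa using (hasDerivAt_pow 2 t).mul_const (L / 2 * ‖v‖ ^ 2)
    have h5 := (h2.sub h3).sub h4
    refine HasDerivAt.congr_deriv h5 ?_
    simp
  have hanti : AntitoneOn
      (fun t : ℝ => f (x + t • v) - t * ⟪f' x, v⟫ - t ^ 2 * (L / 2 * ‖v‖ ^ 2))
      (Set.Icc 0 1) := by
    apply antitoneOn_of_deriv_nonpos (convex_Icc 0 1)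
    · exact fun t _ => (hd t).continuousAt.continuousWithinAt
    · exact fun t _ => (hd t).differentiableAt.differentiableWithinAt
    · intro t ht
      rw [interior_Icc] at ht
      rw [(hd t).deriv, ← inner_sub_left]
      have h1 := real_inner_le_norm (f' (x + t • v) - f' x) v
      have h2 := hL (x + t • v) x
      rw [add_sub_cancel_left, norm_smul, Real.norm_of_nonneg ht.1.le] at h2
      have h3 := mul_le_mul_of_nonneg_right h2 (norm_nonneg v)
      nlinarith
  have h := hanti (Set.left_mem_Icc.2 zero_le_one) (Set.right_mem_Icc.2 zero_le_one) zero_le_one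
  simp at h
  linarith

lemma aux_segment {E : Type*} [NormedAddCommGroup E] [InnerProductSpace ℝ E]
    (f : E → ℝ) (hf : ConvexOn ℝ Set.univ f) (x y : E) (t : ℝ) (ht : 0 < t) (ht1 : t ≤ 1) :
    f (x + t • (y - x)) ≤ f x + t * (f y - f x) := by
  have h := hf.2 (Set.mem_univ x) (Set.mem_univ y) (sub_nonneg.2 ht1) ht.le (by ring)
  have e : (1 - t) • x + t • y = x + t • (y - x) := by module
  rw [e] at h
  simp only [smul_eq_mul] at h
  linarith

lemma aux_convex_grad {E : Type*} [NormedAddCommGroup E] [InnerProductSpace ℝ E] [CompleteSpace E]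
    (f : E → ℝ) (f' : E → E) (hf : ∀ x, HasGradientAt f (f' x) x) (L : ℝ)
    (hL : ∀ x y, ‖f' x - f' y‖ ≤ L * ‖x - y‖) (hc : ConvexOn ℝ Set.univ f) (x y : E) :
    f x + ⟪f' x, y - x⟫ ≤ f y := by
  have h := aux_scalar (f y - f x - ⟪f' x, y - x⟫) (L / 2 * ‖y - x‖ ^ 2) (by
    intro t ht ht1
    have h1 := aux_segment f hc x y t ht ht1
    have h2 := aux_descent (fun z => - f z) (fun z => - f' z)
      (fun z => by
        have := (hf z).hasFDerivAt.neg
        rw [hasGradientAt_iff_hasFDerivAt, map_neg]; exact this) L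
      (fun a b => by
        have e : -f' a - -f' b = -(f' a - f' b) := by abel
        rw [e, norm_neg]; exact hL a b) x (t • (y - x))
    simp only [inner_neg_left, inner_smul_right, norm_smul, Real.norm_of_nonneg ht.le, mul_pow] at h2
    linarith)
  linarith

lemma aux_opt {E : Type*} [NormedAddCommGroup E] [InnerProductSpace ℝ E] [CompleteSpace E]
    (f : E → ℝ) (f' : E → E) (hf : ∀ x, HasGradientAt f (f' x) x) (L : ℝ)
    (hL : ∀ x y, ‖f' x - f' y‖ ≤ L * ‖x - y‖) (ψ : E → ℝ) (hc : ConvexOn ℝ Set.univ ψ) (x : E)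
    (hx : ∀ u, f x + ψ x ≤ f u + ψ u) (y : E) :
    0 ≤ ψ y - ψ x + ⟪f' x, y - x⟫ := by
  apply aux_scalar _ (L / 2 * ‖y - x‖ ^ 2)
  intro t ht ht1
  have h1 := aux_segment ψ hc x y t ht ht1
  have h2 := aux_descent f f' hf L hL x (t • (y - x))
  simp only [inner_smul_right, norm_smul, Real.norm_of_nonneg ht.le, mul_pow] at h2
  have h3 := hx (x + t • (y - x))
  linarith

lemma aux_prox {E : Type*} [NormedAddCommGroup E] [InnerProductSpace ℝ E]
    (ψ : E → ℝ) (hc : ConvexOn ℝ Set.univ ψ) (z y : E) (c : ℝ)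
    (hy : ∀ u, c * ‖z - y‖ ^ 2 + ψ y ≤ c * ‖z - u‖ ^ 2 + ψ u) (u : E) :
    ψ y + c * ‖z - y‖ ^ 2 + c * ‖y - u‖ ^ 2 ≤ ψ u + c * ‖z - u‖ ^ 2 := by
  have h := aux_scalar (ψ u - ψ y - 2 * c * ⟪z - y, u - y⟫) (c * ‖u - y‖ ^ 2) (by
    intro t ht ht1
    have h1 := aux_segment ψ hc y u t ht ht1
    have h2 := hy (y + t • (u - y))
    have e : z - (y + t • (u - y)) = (z - y) - t • (u - y) := by abel
    rw [e, norm_sub_sq_real (z - y), inner_smul_right, norm_smul, Real.norm_of_nonneg ht.le] at h2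
    nlinarith)
  have e : z - u = (z - y) - (u - y) := by abel
  rw [e, norm_sub_sq_real (z - y), norm_sub_rev y u]
  linarith

lemma aux_step {E : Type*} [NormedAddCommGroup E] [InnerProductSpace ℝ E] [CompleteSpace E]
    (f : E → ℝ) (f' : E → E) (hf : ∀ x, HasGradientAt f (f' x) x) (L : ℝ)
    (hL : ∀ x y, ‖f' x - f' y‖ ≤ L * ‖x - y‖) (hfc : ConvexOn ℝ Set.univ f)
    (ψ : E → ℝ) (hc : ConvexOn ℝ Set.univ ψ) (x s g y : E) (η : ℝ) (hη : 0 < η)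
    (hηL : 6 * (η * L) ≤ 1)
    (hy : ∀ u, 1 / (2 * η) * ‖x - η • g - y‖ ^ 2 + ψ y
      ≤ 1 / (2 * η) * ‖x - η • g - u‖ ^ 2 + ψ u) :
    f y + ψ y ≤ f s + ψ s + 1 / (2 * η) * ‖x - s‖ ^ 2 - 1 / (2 * η) * ‖y - s‖ ^ 2
      + ⟪g - f' x, s - x⟫ + 3 * η / 5 * ‖g - f' x‖ ^ 2 := by
  have h1 := aux_prox ψ hc _ _ _ hy s
  have h2 := aux_descent f f' hf L hL x (y - x)
  have h3 := aux_convex_grad f f' hf L hL hfc x s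
  rw [add_sub_cancel] at h2
  have e : ∀ u, 1 / (2 * η) * ‖x - η • g - u‖ ^ 2
      = 1 / (2 * η) * ‖u - x‖ ^ 2 + ⟪g, u - x⟫ + η / 2 * ‖g‖ ^ 2 := by
    intro u
    have e1 : x - η • g - u = -((u - x) + η • g) := by abel
    rw [e1, norm_neg, norm_add_sq_real, inner_smul_right, norm_smul, Real.norm_of_nonneg hη.le,
      real_inner_comm]
    field_simp
  rw [e y, e s] at h1
  have h4 : 0 ≤ ‖(6 * η / 5) • (g - f' x) + (y - x)‖ ^ 2 := sq_nonneg _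
  rw [norm_add_sq_real, inner_smul_left, norm_smul, Real.norm_of_nonneg (by positivity)] at h4
  simp only [conj_trivial] at h4
  have h5 : 0 ≤ 3 * η / 5 * ‖g - f' x‖ ^ 2 + ⟪g - f' x, y - x⟫ + 5 / (12 * η) * ‖y - x‖ ^ 2 := by
    have : 3 * η / 5 * ‖g - f' x‖ ^ 2 + ⟪g - f' x, y - x⟫ + 5 / (12 * η) * ‖y - x‖ ^ 2
      = 5 / (12 * η) * ((6 * η / 5 * ‖g - f' x‖) ^ 2 + 2 * (6 * η / 5 * ⟪g - f' x, y - x⟫)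
        + ‖y - x‖ ^ 2) := by
      field_simp
      ring
    rw [this]; positivity
  have h6 : L / 2 + 5 / (12 * η) ≤ 1 / (2 * η) := by
    rw [← sub_nonneg]
    have : 1 / (2 * η) - (L / 2 + 5 / (12 * η)) = (1 - 6 * (η * L)) / (12 * η) := by
      field_simp; ring
    rw [this]; exact div_nonneg (by linarith) (by positivity)
  have h7 := mul_le_mul_of_nonneg_right h6 (sq_nonneg ‖y - x‖)
  rw [norm_sub_rev x s]
  simp only [inner_sub_left g] at h5 ⊢
  linarith

lemma aux_var {E ι : Type*} [NormedAddCommGroup E] [InnerProductSpace ℝ E] [Fintype ι]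
    (q : ι → ℝ) (hq1 : ∑ i, q i = 1) (a : ι → E) (m : E) (hm : ∑ i, q i • a i = m) :
    ∑ i, q i * ‖a i - m‖ ^ 2 ≤ ∑ i, q i * ‖a i‖ ^ 2 := by
  have : ∑ i, q i * ‖a i - m‖ ^ 2 = ∑ i, q i * ‖a i‖ ^ 2 - 2 * ⟪∑ i, q i • a i, m⟫
      + (∑ i, q i) * ‖m‖ ^ 2 := by
    rw [sum_inner, Finset.mul_sum, Finset.sum_mul, ← Finset.sum_sub_distrib,
      ← Finset.sum_add_distrib]
    refine Finset.sum_congr rfl fun i _ => ?_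
    rw [norm_sub_sq_real, real_inner_smul_left]; ring
  rw [this, hm, hq1, real_inner_self_eq_norm_sq]
  nlinarith [sq_nonneg ‖m‖]

lemma aux_unbias {E : Type*} [NormedAddCommGroup E] [InnerProductSpace ℝ E] {n : ℕ}
    (pC : Finset (Fin n) → ℝ) (θ : Finset (Fin n) → Fin n → ℝ)
    (hunbias : ∀ i, ∑ C ∈ Finset.univ.filter (fun C => i ∈ C), pC C * θ C i = 1)
    (c : ℝ) (a : Fin n → E) :
    ∑ C, pC C • (c • ∑ i ∈ C, θ C i • a i) = c • ∑ i, a i := by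
  have : ∀ C : Finset (Fin n), pC C • (c • ∑ i ∈ C, θ C i • a i)
      = c • ∑ i, if i ∈ C then (pC C * θ C i) • a i else 0 := by
    intro C
    rw [smul_comm, Finset.smul_sum, Finset.sum_ite_mem, Finset.univ_inter]
    simp only [mul_smul]
  simp only [this]
  rw [← Finset.smul_sum, Finset.sum_comm]
  congr 1
  refine Finset.sum_congr rfl fun i _ => ?_
  rw [← Finset.sum_filter, ← Finset.sum_smul, hunbias, one_smul]

/-- Theorem 3 of the paper: one-step inequality for loopless SVRG in the
non-strongly convex composite case, with `α = 6η/(5p)`. -/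
theorem lsvrg_convex_one_step
    {d n : ℕ}
    (f : Fin n → EuclideanSpace ℝ (Fin d) → ℝ)
    (f' : Fin n → EuclideanSpace ℝ (Fin d) → EuclideanSpace ℝ (Fin d))
    (hgrad : ∀ i x, HasGradientAt (f i) (f' i x) x)
    (fbar : EuclideanSpace ℝ (Fin d) → ℝ)
    (hfbar : ∀ u, fbar u = (n : ℝ)⁻¹ * ∑ i, f i u)
    (fgrad : EuclideanSpace ℝ (Fin d) → EuclideanSpace ℝ (Fin d))
    (hfgrad : ∀ u, fgrad u = (n : ℝ)⁻¹ • ∑ i, f' i u)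
    (Lf : ℝ)
    (hfconv : ConvexOn ℝ Set.univ fbar)
    (hfsmooth : LipschitzWith (Real.toNNReal Lf) fgrad)
    (ψ : EuclideanSpace ℝ (Fin d) → ℝ)
    (hψconv : ConvexOn ℝ Set.univ ψ)
    (P : EuclideanSpace ℝ (Fin d) → ℝ) (hP : ∀ u, P u = fbar u + ψ u)
    (xstar : EuclideanSpace ℝ (Fin d)) (hxstar : ∀ u, P xstar ≤ P u)
    (pC : Finset (Fin n) → ℝ) (hpC : ∀ C, 0 ≤ pC C) (hpCsum : ∑ C, pC C = 1)
    (θ : Finset (Fin n) → Fin n → ℝ)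
    (hunbias : ∀ i, ∑ C ∈ Finset.univ.filter (fun C => i ∈ C), pC C * θ C i = 1)
    (L1 : ℝ) (hL1 : 0 < L1)
    (hES : ∀ u, ∑ C, pC C * ‖(n : ℝ)⁻¹ • ∑ i ∈ C, θ C i • (f' i u - f' i xstar)‖ ^ 2
        ≤ 2 * L1 * (fbar u - fbar xstar - ⟪fgrad xstar, u - xstar⟫))
    (η p : ℝ) (hη : 0 < η) (hη' : η ≤ min (1 / (8 * L1)) (1 / (6 * Lf)))
    (hp : 0 < p) (hp' : p ≤ 1)
    (α : ℝ) (hα : α = 6 * η / (5 * p))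
    (x w : EuclideanSpace ℝ (Fin d))
    (g : Finset (Fin n) → EuclideanSpace ℝ (Fin d))
    (hg : ∀ C, g C = (n : ℝ)⁻¹ • ∑ i ∈ C, θ C i • (f' i x - f' i w) + fgrad w)
    (xplus : Finset (Fin n) → EuclideanSpace ℝ (Fin d))
    (hxplus : ∀ C, 0 < pC C → ∀ u,
      1 / (2 * η) * ‖x - η • g C - xplus C‖ ^ 2 + ψ (xplus C)
        ≤ 1 / (2 * η) * ‖x - η • g C - u‖ ^ 2 + ψ u)
    (H : EuclideanSpace ℝ (Fin d) → ℝ)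
    (hH : ∀ u, H u = ∑ C, pC C * ‖(n : ℝ)⁻¹ • ∑ i ∈ C, θ C i • (f' i u - f' i xstar)‖ ^ 2) :
    ∑ C, pC C * P (xplus C) - P xstar - 3 / 5 * (P x - P xstar)
      ≤ (1 / (2 * η) * ‖x - xstar‖ ^ 2 + α * H w)
        - (∑ C, pC C * (1 / (2 * η) * ‖xplus C - xstar‖ ^ 2)
            + α * (p * H x + (1 - p) * H w)) := by
  have hη1 : η * (8 * L1) ≤ 1 := (le_div_iff₀ (by positivity)).1 (hη'.trans (min_le_left _ _))
  have hη2 := hη'.trans (min_le_right _ _)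
  have hLf : 0 < Lf := by
    have := hη.trans_le hη2
    rw [one_div_pos] at this; linarith
  have hη3 : 6 * (η * Lf) ≤ 1 := by
    have := (le_div_iff₀ (by positivity)).1 hη2; linarith
  have hL : ∀ a b, ‖fgrad a - fgrad b‖ ≤ Lf * ‖a - b‖ := by
    intro a b
    have := hfsmooth.dist_le_mul a b
    rwa [dist_eq_norm, dist_eq_norm, Real.coe_toNNReal _ hLf.le] at this
  have hgf : ∀ a, HasGradientAt fbar (fgrad a) a := by
    intro a
    have h1 := (HasFDerivAt.fun_sum (u := Finset.univ)
      (fun i _ => (hgrad i a).hasFDerivAt)).const_mul ((n : ℝ)⁻¹)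
    have h2 : fbar = fun u => (n : ℝ)⁻¹ * ∑ i, f i u := funext hfbar
    rw [hasGradientAt_iff_hasFDerivAt, h2, hfgrad, map_smul, map_sum]
    exact h1
  -- variance
  let G : EuclideanSpace ℝ (Fin d) → Finset (Fin n) → EuclideanSpace ℝ (Fin d) :=
    fun u C => (n : ℝ)⁻¹ • ∑ i ∈ C, θ C i • (f' i u - f' i xstar)
  have hGd : ∀ C, (n : ℝ)⁻¹ • ∑ i ∈ C, θ C i • (f' i x - f' i w) = G x C - G w C := by
    intro C
    simp only [G]
    rw [← smul_sub, ← Finset.sum_sub_distrib]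
    congr 1
    refine Finset.sum_congr rfl fun i _ => ?_
    rw [← smul_sub, sub_sub_sub_cancel_right]
  have hmean : ∑ C, pC C • (G x C - G w C) = fgrad x - fgrad w := by
    simp only [← hGd]
    rw [aux_unbias pC θ hunbias, Finset.sum_sub_distrib, smul_sub, hfgrad, hfgrad]
  have hv : ∀ C, g C - fgrad x = (G x C - G w C) - (fgrad x - fgrad w) := by
    intro C
    rw [hg, hGd]; abel
  have hv0 : ∑ C, pC C • (g C - fgrad x) = 0 := by
    simp only [hv, smul_sub _ _ (fgrad x - fgrad w), Finset.sum_sub_distrib]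
    rw [hmean, ← Finset.sum_smul, hpCsum, one_smul, sub_self]
  have hvar : ∑ C, pC C * ‖g C - fgrad x‖ ^ 2 ≤ 2 * H x + 2 * H w := by
    simp only [hv]
    refine (aux_var pC hpCsum _ _ hmean).trans ?_
    rw [hH, hH, Finset.mul_sum, Finset.mul_sum, ← Finset.sum_add_distrib]
    refine Finset.sum_le_sum fun C _ => ?_
    change _ ≤ 2 * (pC C * ‖G x C‖ ^ 2) + 2 * (pC C * ‖G w C‖ ^ 2)
    have h1 := parallelogram_law_with_norm ℝ (G x C) (G w C)
    have h2 : ‖G x C - G w C‖ ^ 2 ≤ 2 * ‖G x C‖ ^ 2 + 2 * ‖G w C‖ ^ 2 := by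
      nlinarith [mul_self_nonneg ‖G x C + G w C‖]
    nlinarith [mul_le_mul_of_nonneg_left h2 (hpC C)]
  have hstep : ∑ C, pC C * P (xplus C) ≤ ∑ C, (pC C * P xstar
      + pC C * (1 / (2 * η) * ‖x - xstar‖ ^ 2) - pC C * (1 / (2 * η) * ‖xplus C - xstar‖ ^ 2)
      + ⟪pC C • (g C - fgrad x), xstar - x⟫ + 3 * η / 5 * (pC C * ‖g C - fgrad x‖ ^ 2)) := by
    refine Finset.sum_le_sum fun C _ => ?_
    rcases (hpC C).eq_or_lt with h0 | h0
    · simp [← h0]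
    · have h := aux_step fbar fgrad hgf Lf hL hfconv ψ hψconv x xstar (g C) (xplus C) η hη hη3
        (hxplus C h0)
      rw [← hP, ← hP] at h
      have h' := mul_le_mul_of_nonneg_left h h0.le
      rw [real_inner_smul_left]
      linarith
  rw [Finset.sum_add_distrib, Finset.sum_add_distrib, Finset.sum_sub_distrib,
    Finset.sum_add_distrib, ← Finset.sum_mul, ← Finset.sum_mul, hpCsum, ← sum_inner, hv0,
    inner_zero_left, ← Finset.mul_sum] at hstep
  have hopt := aux_opt fbar fgrad hgf Lf hL ψ hψconv xstar
    (fun u => by rw [← hP, ← hP]; exact hxstar u) x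
  have hcv := aux_convex_grad fbar fgrad hgf Lf hL hfconv xstar x
  have hHx : H x ≤ 2 * L1 * (fbar x - fbar xstar - ⟪fgrad xstar, x - xstar⟫) := by
    rw [hH]; exact hES x
  have hD : fbar x - fbar xstar - ⟪fgrad xstar, x - xstar⟫ ≤ P x - P xstar := by
    rw [hP, hP]; linarith
  set D := fbar x - fbar xstar - ⟪fgrad xstar, x - xstar⟫ with hDdef
  have hD0 : 0 ≤ D := by linarith
  have hαp : α * p = 6 * η / 5 := by rw [hα]; field_simp
  have h1 : η * H x ≤ η * (2 * L1 * D) := mul_le_mul_of_nonneg_left hHx hη.le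
  have h2 : η * (8 * L1) * D ≤ 1 * D := mul_le_mul_of_nonneg_right hη1 hD0
  have h3 : 3 * η / 5 * ∑ C, pC C * ‖g C - fgrad x‖ ^ 2 ≤ 3 * η / 5 * (2 * H x + 2 * H w) :=
    mul_le_mul_of_nonneg_left hvar (by positivity)
  have h4 : α * (p * H x + (1 - p) * H w) = α * H w + 6 * η / 5 * (H x - H w) := by
    rw [← hαp]; ring
  rw [h4]
  linarith
end

section
/- Let f_i : ℝ^d → ℝ be convex, differentiable and L_i-smooth, and let f = (1/n) Σ_{i=1}^n f_i be convex and L_f-smooth. Let p̃_i > 0 with Σ_i p̃_i = 1, let τ ≥ 1 be an integer, and draw i_1,…,i_τ independently with P[i_k = i] = p̃_i. Then for all x, y ∈ ℝ^d: E ‖(1/(nτ)) Σ_{k=1}^τ (1/p̃_{i_k})(∇f_{i_k}(x) − ∇f_{i_k}(y))‖² ≤ 2 [ (1/(nτ)) max_{i∈[n]} (L_i/p̃_i) + (1 − 1/τ) L_f ] · (f(x) − f(y) − ⟨∇f(y), x − y⟩). -/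
open scoped RealInnerProductSpace BigOperators

section Aux
variable {E : Type*} [NormedAddCommGroup E] [InnerProductSpace ℝ E] [CompleteSpace E]

lemma aux_line (g : E → ℝ) (g' : E → E) (hg : ∀ x, HasGradientAt g (g' x) x) (x v : E) (t : ℝ) :
    HasDerivAt (fun t : ℝ => g (x + t • v)) ⟪g' (x + t • v), v⟫ t := by
  have h1 : HasDerivAt (fun t : ℝ => x + t • v) v t := by
    simpa using ((hasDerivAt_id t).smul_const v).const_add x
  have h2 := (hg (x + t • v)).hasFDerivAt.comp_hasDerivAt t h1
  rw [InnerProductSpace.toDual_apply_apply] at h2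
  exact h2

lemma aux_descent_s15 (g : E → ℝ) (g' : E → E) (hg : ∀ x, HasGradientAt g (g' x) x) (K : ℝ)
    (hK : ∀ x y, ‖g' x - g' y‖ ≤ K * ‖x - y‖) (x v : E) :
    g (x + v) ≤ g x + ⟪g' x, v⟫ + K / 2 * ‖v‖ ^ 2 := by
  have hd : ∀ t : ℝ, HasDerivAt
      (fun t : ℝ => g (x + t • v) - t * ⟪g' x, v⟫ - t ^ 2 * (K / 2 * ‖v‖ ^ 2))
      (⟪g' (x + t • v), v⟫ - ⟪g' x, v⟫ - 2 * t * (K / 2 * ‖v‖ ^ 2)) t := by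
    intro t
    have h := ((aux_line g g' hg x v t).sub ((hasDerivAt_id t).mul_const ⟪g' x, v⟫)).sub
      (((hasDerivAt_id t).pow 2).mul_const (K / 2 * ‖v‖ ^ 2))
    convert! h using 1
    simp
  have hanti := antitoneOn_of_deriv_nonpos (convex_Icc (0 : ℝ) 1)
    (fun t _ => (hd t).continuousAt.continuousWithinAt)
    (fun t _ => (hd t).differentiableAt.differentiableWithinAt)
    (fun t ht => by
      rw [interior_Icc] at ht
      rw [(hd t).deriv, ← inner_sub_left]
      have h1 := real_inner_le_norm (g' (x + t • v) - g' x) v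
      have h2 := hK (x + t • v) x
      rw [add_sub_cancel_left, norm_smul, Real.norm_of_nonneg ht.1.le] at h2
      nlinarith [mul_le_mul_of_nonneg_right h2 (norm_nonneg v)])
  have := hanti (Set.left_mem_Icc.2 zero_le_one) (Set.right_mem_Icc.2 zero_le_one) zero_le_one
  simp at this
  linarith

lemma aux_convex (g : E → ℝ) (g' : E → E) (hg : ∀ x, HasGradientAt g (g' x) x)
    (hc : ConvexOn ℝ Set.univ g) (x v : E) :
    g x + ⟪g' x, v⟫ ≤ g (x + v) := by
  have hφ : ConvexOn ℝ Set.univ (fun t : ℝ => g (x + t • v)) := by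
    have h := hc.comp_affineMap (AffineMap.lineMap x (x + v) : ℝ →ᵃ[ℝ] E)
    have e : (g ∘ (AffineMap.lineMap x (x + v) : ℝ →ᵃ[ℝ] E)) = fun t : ℝ => g (x + t • v) := by
      ext t
      simp [AffineMap.lineMap_apply, add_comm]
    rw [e] at h
    simpa using h
  have h := hφ.le_slope_of_hasDerivAt (Set.mem_univ 0) (Set.mem_univ 1) zero_lt_one
    (aux_line g g' hg x v 0)
  simp [slope_def_field] at h
  linarith

lemma aux_coco (g : E → ℝ) (g' : E → E) (hg : ∀ x, HasGradientAt g (g' x) x)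
    (hc : ConvexOn ℝ Set.univ g) (K : ℝ) (hK0 : 0 ≤ K)
    (hL : LipschitzWith (Real.toNNReal K) g') (x y : E) :
    ‖g' x - g' y‖ ^ 2 ≤ 2 * K * (g x - g y - ⟪g' y, x - y⟫) := by
  have hK : ∀ x y, ‖g' x - g' y‖ ≤ K * ‖x - y‖ := by
    intro x y
    simpa [dist_eq_norm, hK0] using hL.dist_le_mul x y
  rcases hK0.eq_or_lt with h0 | hpos
  · subst h0
    have := hK x y
    have h2 : ‖g' x - g' y‖ = 0 := le_antisymm (by simpa using this) (norm_nonneg _)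
    simp [h2]
  · have h1 := aux_descent_s15 g g' hg K hK x (-(K⁻¹ • (g' x - g' y)))
    have h2 := aux_convex g g' hg hc y (x - y + -(K⁻¹ • (g' x - g' y)))
    have e : y + (x - y + -(K⁻¹ • (g' x - g' y))) = x + -(K⁻¹ • (g' x - g' y)) := by abel
    rw [e] at h2
    have h3 : ⟪g' x, g' x - g' y⟫ - ⟪g' y, g' x - g' y⟫ = ‖g' x - g' y‖ ^ 2 := by
      rw [← inner_sub_left, real_inner_self_eq_norm_sq]
    rw [norm_neg, norm_smul, Real.norm_of_nonneg (inv_nonneg.2 hK0), inner_neg_right,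
      inner_smul_right] at h1
    rw [inner_add_right, inner_neg_right, inner_smul_right] at h2
    have h4 : K⁻¹ * ‖g' x - g' y‖ ^ 2 - K / 2 * (K⁻¹ * ‖g' x - g' y‖) ^ 2
        ≤ g x - g y - ⟪g' y, x - y⟫ := by
      rw [← h3] at *
      linarith
    have h5 : K⁻¹ * ‖g' x - g' y‖ ^ 2 - K / 2 * (K⁻¹ * ‖g' x - g' y‖) ^ 2
        = ‖g' x - g' y‖ ^ 2 / (2 * K) := by
      field_simp
      ring
    rw [h5, div_le_iff₀ (by positivity)] at h4
    linarith

lemma aux_mass {n : ℕ} (p : Fin n → ℝ) (hp : ∑ i, p i = 1) (τ : ℕ) :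
    ∑ idx : Fin τ → Fin n, ∏ k, p (idx k) = 1 := by
  rw [← Fintype.prod_sum]
  simp [hp]

lemma aux_cons {n τ : ℕ} {M : Type*} [AddCommMonoid M] (F : (Fin (τ + 1) → Fin n) → M) :
    ∑ idx, F idx = ∑ i, ∑ idx : Fin τ → Fin n, F (Fin.cons i idx) := by
  rw [← (Fin.consEquiv (fun _ => Fin n)).sum_comp, Fintype.sum_prod_type]
  rfl

lemma aux_mean {n : ℕ} (p : Fin n → ℝ) (hp : ∑ i, p i = 1) (v : Fin n → E) (τ : ℕ) :
    ∑ idx : Fin τ → Fin n, (∏ k, p (idx k)) • ∑ k, v (idx k) = (τ : ℝ) • ∑ i, p i • v i := by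
  induction τ with
  | zero => simp
  | succ τ ih =>
    rw [aux_cons]
    simp only [Fin.prod_univ_succ, Fin.sum_univ_succ, Fin.cons_zero, Fin.cons_succ, smul_add,
      Finset.sum_add_distrib, mul_smul, ← Finset.smul_sum, ih]
    simp only [← Finset.sum_smul, aux_mass p hp, hp]
    simp only [Nat.cast_add, Nat.cast_one, add_smul, one_smul]
    abel

lemma aux_second {n : ℕ} (p : Fin n → ℝ) (hp : ∑ i, p i = 1) (v : Fin n → E) (τ : ℕ) :
    ∑ idx : Fin τ → Fin n, (∏ k, p (idx k)) * ‖∑ k, v (idx k)‖ ^ 2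
      = τ * ∑ i, p i * ‖v i‖ ^ 2 + τ * (τ - 1) * ‖∑ i, p i • v i‖ ^ 2 := by
  induction τ with
  | zero => simp
  | succ τ ih =>
    rw [aux_cons]
    have key : ∀ i, ∑ idx : Fin τ → Fin n, (p i * ∏ k, p (idx k)) * ‖v i + ∑ k, v (idx k)‖ ^ 2
        = p i * ‖v i‖ ^ 2 + 2 * τ * ⟪p i • v i, ∑ i, p i • v i⟫
          + p i * (τ * ∑ i, p i * ‖v i‖ ^ 2 + τ * (τ - 1) * ‖∑ i, p i • v i‖ ^ 2) := by
      intro i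
      have hm : ∑ idx : Fin τ → Fin n, (∏ k, p (idx k)) * ⟪v i, ∑ k, v (idx k)⟫
          = τ * ⟪v i, ∑ i, p i • v i⟫ := by
        rw [← inner_smul_right, ← aux_mean p hp v τ, inner_sum]
        simp only [inner_smul_right]
      have : ∀ idx : Fin τ → Fin n, (p i * ∏ k, p (idx k)) * ‖v i + ∑ k, v (idx k)‖ ^ 2
          = (p i * ‖v i‖ ^ 2) * ∏ k, p (idx k)
            + (2 * p i) * ((∏ k, p (idx k)) * ⟪v i, ∑ k, v (idx k)⟫)
            + p i * ((∏ k, p (idx k)) * ‖∑ k, v (idx k)‖ ^ 2) := by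
        intro idx
        rw [norm_add_sq_real]
        ring
      simp only [this, Finset.sum_add_distrib, ← Finset.mul_sum]
      rw [aux_mass p hp, hm, ih, real_inner_smul_left]
      ring
    simp only [Fin.prod_univ_succ, Fin.sum_univ_succ, Fin.cons_zero, Fin.cons_succ, key]
    rw [Finset.sum_add_distrib, Finset.sum_add_distrib, ← Finset.mul_sum, ← sum_inner,
      real_inner_self_eq_norm_sq, ← Finset.sum_mul, hp]
    push_cast
    ring

end Aux

/-- Lemma `L1sp` of the paper: expected smoothness constant ℒ₁ for
sampling with replacement: τ indices are drawn i.i.d. from the distribution `pt`. -/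
theorem L1_sampling_with_replacement
    {d n : ℕ} (hn : 0 < n) (τ : ℕ) (hτ : 1 ≤ τ)
    (f : Fin n → EuclideanSpace ℝ (Fin d) → ℝ)
    (f' : Fin n → EuclideanSpace ℝ (Fin d) → EuclideanSpace ℝ (Fin d))
    (hgrad : ∀ i x, HasGradientAt (f i) (f' i x) x)
    (L : Fin n → ℝ) (hL0 : ∀ i, 0 ≤ L i)
    (hconv : ∀ i, ConvexOn ℝ Set.univ (f i))
    (hsmooth : ∀ i, LipschitzWith (Real.toNNReal (L i)) (f' i))
    (fbar : EuclideanSpace ℝ (Fin d) → ℝ)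
    (hfbar : ∀ u, fbar u = (n : ℝ)⁻¹ * ∑ i, f i u)
    (fgrad : EuclideanSpace ℝ (Fin d) → EuclideanSpace ℝ (Fin d))
    (hfgrad : ∀ u, fgrad u = (n : ℝ)⁻¹ • ∑ i, f' i u)
    (Lf : ℝ) (hLf0 : 0 ≤ Lf)
    (hfconv : ConvexOn ℝ Set.univ fbar)
    (hfsmooth : LipschitzWith (Real.toNNReal Lf) fgrad)
    (pt : Fin n → ℝ) (hpt : ∀ i, 0 < pt i) (hptsum : ∑ i, pt i = 1)
    (x y : EuclideanSpace ℝ (Fin d)) :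
    ∑ idx : Fin τ → Fin n, (∏ k, pt (idx k)) *
        ‖((n : ℝ) * (τ : ℝ))⁻¹ • ∑ k, (pt (idx k))⁻¹ • (f' (idx k) x - f' (idx k) y)‖ ^ 2
      ≤ 2 * (((n : ℝ) * (τ : ℝ))⁻¹ *
            (Finset.univ.sup' (Finset.univ_nonempty_iff.mpr (Fin.pos_iff_nonempty.mp hn))
              (fun i => L i / pt i))
          + (1 - 1 / (τ : ℝ)) * Lf)
        * (fbar x - fbar y - ⟪fgrad y, x - y⟫) := by
  have hn' : (0 : ℝ) < n := by exact_mod_cast hn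
  have hτ' : (1 : ℝ) ≤ τ := by exact_mod_cast hτ
  have hτ0 : (0 : ℝ) < τ := by linarith
  have hbargrad : ∀ u, HasGradientAt fbar (fgrad u) u := by
    intro u
    have h : HasFDerivAt (fun u => (n : ℝ)⁻¹ * ∑ i, f i u)
        ((n : ℝ)⁻¹ • ∑ i, InnerProductSpace.toDual ℝ _ (f' i u)) u :=
      (HasFDerivAt.fun_sum (fun i _ => (hgrad i u).hasFDerivAt)).const_mul _
    rw [hasGradientAt_iff_hasFDerivAt, funext hfbar, hfgrad u]
    convert! h using 1
    ext z
    simp [inner_smul_left, sum_inner]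
  set M := Finset.univ.sup' (Finset.univ_nonempty_iff.mpr (Fin.pos_iff_nonempty.mp hn))
              (fun i => L i / pt i) with hM
  set D := fbar x - fbar y - ⟪fgrad y, x - y⟫ with hD
  have hDsum : ∑ i, (f i x - f i y - ⟪f' i y, x - y⟫) = n * D := by
    rw [hD, hfbar, hfbar, hfgrad, real_inner_smul_left, sum_inner, Finset.sum_sub_distrib,
      Finset.sum_sub_distrib]
    field_simp
  have hB := aux_coco fbar fgrad hbargrad hfconv Lf hLf0 hfsmooth x y
  have hA : ∑ i, pt i * ‖(pt i)⁻¹ • (f' i x - f' i y)‖ ^ 2 ≤ 2 * M * (n * D) := by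
    rw [← hDsum, Finset.mul_sum]
    refine Finset.sum_le_sum fun i _ => ?_
    have hp := hpt i
    have h1 := aux_coco (f i) (f' i) (hgrad i) (hconv i) (L i) (hL0 i) (hsmooth i) x y
    have h2 : L i / pt i ≤ M :=
      Finset.le_sup' (fun i => L i / pt i) (Finset.mem_univ i)
    have h3 := aux_convex (f i) (f' i) (hgrad i) (hconv i) y (x - y)
    rw [add_sub_cancel] at h3
    have h4 : 0 ≤ f i x - f i y - ⟪f' i y, x - y⟫ := by linarith
    rw [norm_smul, Real.norm_of_nonneg (inv_nonneg.2 hp.le)]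
    calc pt i * ((pt i)⁻¹ * ‖f' i x - f' i y‖) ^ 2
        = ‖f' i x - f' i y‖ ^ 2 / pt i := by field_simp
      _ ≤ (2 * L i * (f i x - f i y - ⟪f' i y, x - y⟫)) / pt i := by gcongr
      _ = 2 * (L i / pt i) * (f i x - f i y - ⟪f' i y, x - y⟫) := by ring
      _ ≤ _ := by gcongr
  have hmean : ∑ i, pt i • (pt i)⁻¹ • (f' i x - f' i y) = (n : ℝ) • (fgrad x - fgrad y) := by
    rw [hfgrad, hfgrad, ← smul_sub, smul_inv_smul₀ hn'.ne', ← Finset.sum_sub_distrib]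
    exact Finset.sum_congr rfl fun i _ => smul_inv_smul₀ (hpt i).ne' _
  have hS := aux_second pt hptsum (fun i => (pt i)⁻¹ • (f' i x - f' i y)) τ
  simp only [hmean] at hS
  have hLHS : ∑ idx : Fin τ → Fin n, (∏ k, pt (idx k)) *
        ‖((n : ℝ) * (τ : ℝ))⁻¹ • ∑ k, (pt (idx k))⁻¹ • (f' (idx k) x - f' (idx k) y)‖ ^ 2
      = (((n : ℝ) * (τ : ℝ))⁻¹) ^ 2 * ∑ idx : Fin τ → Fin n, (∏ k, pt (idx k)) *
        ‖∑ k, (pt (idx k))⁻¹ • (f' (idx k) x - f' (idx k) y)‖ ^ 2 := by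
    rw [Finset.mul_sum]
    refine Finset.sum_congr rfl fun idx _ => ?_
    rw [norm_smul, Real.norm_of_nonneg (by positivity)]
    ring
  rw [hLHS, hS, norm_smul, Real.norm_of_nonneg hn'.le, mul_pow]
  have hτ1 : (0 : ℝ) ≤ τ - 1 := by linarith
  calc _ ≤ (((n : ℝ) * (τ : ℝ))⁻¹) ^ 2 * (τ * (2 * M * (n * D))
          + τ * (τ - 1) * ((n : ℝ) ^ 2 * (2 * Lf * D))) := by gcongr
    _ = _ := by
      field_simp
end
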